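/- For every n ≥ 1, det H_n^2(g) ≡ 0 (mod 2) if n ≡ 1 or 4 (mod 6), and det H_n^2(g) ≡ 1 (mod 2) if n ≡ 0, 2, 3, or 5 (mod 6), where g is the ruler function g(n) = ν₂(2n). -/

import Mathlib

/-- The Hankel matrix `H_n^p(u)` of a sequence `u`: the `n × n` matrix whose
`(i, j)` entry (for `1 ≤ i, j ≤ n`) is `u (p + i + j - 2)`. -/
def hankelMatrix (n p : ℕ) (u : ℕ → ℤ) : Matrix (Fin n) (Fin n) ℤ :=
  Matrix.of fun i j => u (p + i + j)

/-- The ruler function `g(n) = ν₂(2n)`. -/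
def ruler (n : ℕ) : ℤ := (padicValNat 2 (2 * n) : ℤ)

open Polynomial in
def HSing (F : PowerSeries (ZMod 2)) (n : ℕ) : Prop :=
  ∃ Q P : (ZMod 2)[X], Q ≠ 0 ∧ (∀ m, n ≤ m → Q.coeff m = 0) ∧ (∀ m, n ≤ m → P.coeff m = 0) ∧
    (PowerSeries.X : PowerSeries (ZMod 2)) ^ (2 * n) ∣ F * (Q : PowerSeries (ZMod 2)) - P

open Polynomial in
lemma poly_dvd (d : ℕ) (P : (ZMod 2)[X])
    (h : (PowerSeries.X : PowerSeries (ZMod 2)) ^ d ∣ (P : PowerSeries (ZMod 2))) :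
    ∃ P' : (ZMod 2)[X], P = X ^ d * P' := by
  have : X ^ d ∣ P := by
    rw [Polynomial.X_pow_dvd_iff]
    rw [PowerSeries.X_pow_dvd_iff] at h
    intro m hm
    simpa using h m hm
  exact this

open Polynomial in
lemma poly_small (d : ℕ) (P : (ZMod 2)[X])
    (h : (PowerSeries.X : PowerSeries (ZMod 2)) ^ d ∣ (P : PowerSeries (ZMod 2)))
    (hs : ∀ m, d ≤ m → P.coeff m = 0) : P = 0 := by
  ext m
  rcases lt_or_ge m d with hm | hm
  · rw [PowerSeries.X_pow_dvd_iff] at h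
    simpa using h m hm
  · simpa using hs m hm

open Polynomial in
lemma mul_small (n d : ℕ) (P A : (ZMod 2)[X]) (hP : ∀ m, n ≤ m → P.coeff m = 0)
    (hA : A.natDegree ≤ d) : ∀ m, n + d ≤ m → (P * A).coeff m = 0 := by
  intro m hm
  rw [Polynomial.coeff_mul]
  apply Finset.sum_eq_zero
  rintro ⟨a, b⟩ hab
  rw [Finset.HasAntidiagonal.mem_antidiagonal] at hab
  change a + b = m at hab
  change P.coeff a * A.coeff b = 0
  rcases lt_or_ge a n with h | h
  · rw [Polynomial.coeff_eq_zero_of_natDegree_lt (n := b) (by omega), mul_zero]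
  · simp [hP a h]

open Polynomial in
lemma HSing_step (F K : PowerSeries (ZMod 2)) (A : (ZMod 2)[X]) (d n : ℕ) (hd : 1 ≤ d)
    (hA : A.natDegree ≤ d) (hA0 : A.coeff 0 = 1)
    (h : F * ((A : PowerSeries (ZMod 2)) + PowerSeries.X ^ d * K) = PowerSeries.X ^ d) :
    HSing F (n + d) ↔ HSing K n := by
  have hU : IsUnit ((A : PowerSeries (ZMod 2)) + PowerSeries.X ^ d * K) := by
    rw [PowerSeries.isUnit_iff_constantCoeff]
    have : d ≠ 0 := by omega
    simp [this, hA0]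
  set U := (A : PowerSeries (ZMod 2)) + PowerSeries.X ^ d * K with hUdef
  obtain ⟨V, hV⟩ := hU.exists_right_inv
  have hF : F = PowerSeries.X ^ d * V := by
    rw [← h, mul_assoc, hV, mul_one]
  have hX : ∀ e, (PowerSeries.X : PowerSeries (ZMod 2)) ^ e ≠ 0 :=
    fun e => pow_ne_zero _ PowerSeries.X_ne_zero
  constructor
  · rintro ⟨Q, P, hQ, hQd, hPd, R, hR⟩
    obtain ⟨P', rfl⟩ := poly_dvd d P (by
      refine ⟨V * Q.toPowerSeries - PowerSeries.X ^ (2 * n + d) * R, ?_⟩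
      have : (P : PowerSeries (ZMod 2)) = F * Q.toPowerSeries - PowerSeries.X ^ (2 * (n + d)) * R := by
        rw [← hR]; ring
      rw [this, hF]; ring)
    have hP' : ∀ m, n ≤ m → P'.coeff m = 0 := by
      intro m hm
      have := hPd (m + d) (by omega)
      rwa [Polynomial.coeff_X_pow_mul] at this
    have h1 : Q.toPowerSeries - P'.toPowerSeries * U = PowerSeries.X ^ (2 * n + d) * (R * U) := by
      apply mul_left_cancel₀ (hX d)
      push_cast at hR
      linear_combination U * hR - Q.toPowerSeries * h
    obtain ⟨Q', hQ'⟩ := poly_dvd d (Q - P' * A) (by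
      refine ⟨P'.toPowerSeries * K + PowerSeries.X ^ (2 * n) * (R * U), ?_⟩
      push_cast
      rw [hUdef] at h1 ⊢
      linear_combination h1)
    have hQ'2 : Q.toPowerSeries - P'.toPowerSeries * A.toPowerSeries = PowerSeries.X ^ d * Q'.toPowerSeries := by
      have := congrArg (fun p : (ZMod 2)[X] => (p : PowerSeries (ZMod 2))) hQ'
      simpa using this
    have hPA := mul_small n d P' A hP' hA
    refine ⟨P', Q', ?_, hP', ?_, -(R * U), ?_⟩
    · rintro rfl
      apply hQ
      apply poly_small (n + d) Q _ hQd
      refine ⟨PowerSeries.X ^ n * (R * U), ?_⟩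
      simp only [Polynomial.coe_zero, zero_mul, sub_zero] at h1
      rw [h1]; ring
    · intro m hm
      have := congrArg (fun p => Polynomial.coeff p (m + d)) hQ'
      simp only [Polynomial.coeff_X_pow_mul, Polynomial.coeff_sub] at this
      rw [← this, hQd _ (by omega), hPA _ (by omega), sub_zero]
    · apply mul_left_cancel₀ (hX d)
      rw [hUdef] at h1 ⊢
      linear_combination hQ'2 - h1
  · rintro ⟨Q', P', hQ', hQd, hPd, R, hR⟩
    have hQA := mul_small n d Q' A hQd hA
    have key : F * ((Q' * A + X ^ d * P' : (ZMod 2)[X]) : PowerSeries (ZMod 2))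
        - ((X ^ d * Q' : (ZMod 2)[X]) : PowerSeries (ZMod 2))
        = PowerSeries.X ^ (2 * (n + d)) * (- (V * R)) := by
      push_cast
      have e : F * PowerSeries.X ^ d = PowerSeries.X ^ (2 * d) * V := by rw [hF]; ring
      rw [hUdef] at h
      linear_combination Q'.toPowerSeries * h - F * PowerSeries.X ^ d * hR - PowerSeries.X ^ (2 * n) * R * e
    refine ⟨Q' * A + X ^ d * P', X ^ d * Q', ?_, ?_, ?_, _, key⟩
    · intro h0
      apply hQ'
      rw [h0] at key
      have : X ^ d * Q' = 0 := by
        apply poly_small (n + d)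
        · refine ⟨PowerSeries.X ^ (n + d) * (V * R), ?_⟩
          simp only [Polynomial.coe_zero, mul_zero, zero_sub] at key
          linear_combination - key
        · intro m hm
          obtain ⟨k, rfl⟩ : ∃ k, m = k + d := ⟨m - d, by omega⟩
          rw [Polynomial.coeff_X_pow_mul]; exact hQd k (by omega)
      rcases mul_eq_zero.1 this with h | h
      · exact absurd h (pow_ne_zero _ Polynomial.X_ne_zero)
      · exact h
    · intro m hm
      rw [Polynomial.coeff_add, hQA m hm]
      obtain ⟨k, rfl⟩ : ∃ k, m = k + d := ⟨m - d, by omega⟩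
      rw [Polynomial.coeff_X_pow_mul, hPd k (by omega), add_zero]
    · intro m hm
      obtain ⟨k, rfl⟩ : ∃ k, m = k + d := ⟨m - d, by omega⟩
      rw [Polynomial.coeff_X_pow_mul]; exact hQd k (by omega)

def rulerF : PowerSeries (ZMod 2) :=
  PowerSeries.mk fun k => if k = 0 then 0 else ((ruler (k + 1) : ℤ) : ZMod 2)

lemma ruler_odd (m : ℕ) : ruler (2 * m + 1) = 1 := by
  unfold ruler
  rw [padicValNat.mul (by norm_num) (by omega), padicValNat.self (by norm_num),
    padicValNat.eq_zero_of_not_dvd (by omega)]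
  norm_num

lemma ruler_even (m : ℕ) (hm : m ≠ 0) : ruler (2 * m) = 1 + ruler m := by
  unfold ruler
  rw [padicValNat.mul (by norm_num) (by omega), padicValNat.self (by norm_num)]
  push_cast; ring

lemma sq_coeff (F : PowerSeries (ZMod 2)) (m : ℕ) :
    PowerSeries.coeff m (F ^ 2) = if 2 ∣ m then PowerSeries.coeff (m / 2) F else 0 := by
  rw [← PowerSeries.coeff_expand 2 (by norm_num)]
  have := MvPowerSeries.map_frobenius_expand (R := ZMod 2) 2 (by norm_num) (f := F)
  rw [ZMod.frobenius_zmod] at this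
  rw [← this]
  simp [PowerSeries.expand]

lemma zmod2_add_self (a : ZMod 2) : a + a = 0 := CharTwo.add_self_eq_zero a

lemma rulerF_aux : rulerF + PowerSeries.X * rulerF ^ 2 =
    PowerSeries.mk fun k => if k < 2 then (0 : ZMod 2) else 1 := by
  ext k
  rw [PowerSeries.coeff_mk, map_add]
  rcases k with _ | k
  · simp [rulerF]
  rw [PowerSeries.coeff_succ_X_mul, sq_coeff]
  rcases Nat.even_or_odd' k with ⟨m, rfl | rfl⟩
  · rw [if_pos (by omega), Nat.mul_div_cancel_left _ (by norm_num)]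
    simp only [rulerF, PowerSeries.coeff_mk]
    rw [show 2 * m + 1 + 1 = 2 * (m + 1) by ring, ruler_even _ (by omega), if_neg (by omega)]
    rcases m with _ | m
    · have : ruler 1 = 1 := ruler_odd 0
      simp [this]; decide
    · rw [if_neg (by omega), if_neg (by omega)]
      push_cast
      rw [add_assoc, zmod2_add_self, add_zero]
  · rw [if_neg (by omega), if_neg (by omega)]
    simp only [rulerF, PowerSeries.coeff_mk]
    rw [show 2 * m + 1 + 1 + 1 = 2 * (m + 1) + 1 by ring, ruler_odd, if_neg (by omega)]
    simp

lemma rulerF_eq : (1 + PowerSeries.X) * (rulerF * (1 + PowerSeries.X * rulerF)) =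
    PowerSeries.X ^ 2 := by
  have : rulerF * (1 + PowerSeries.X * rulerF) = rulerF + PowerSeries.X * rulerF ^ 2 := by ring
  rw [this, rulerF_aux]
  ext k
  rw [add_mul, one_mul, map_add, PowerSeries.coeff_X_pow]
  rcases k with _ | _ | _ | k
  · simp
  · rw [PowerSeries.coeff_succ_X_mul]; simp
  · rw [PowerSeries.coeff_succ_X_mul]; simp
  · rw [PowerSeries.coeff_succ_X_mul]; simp [zmod2_add_self]

lemma exists_K : ∃ K : PowerSeries (ZMod 2), K * (1 + PowerSeries.X * rulerF) = PowerSeries.X ∧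
    rulerF * (1 + PowerSeries.X + PowerSeries.X ^ 2 * K) = PowerSeries.X ^ 2 := by
  have hU : IsUnit (1 + PowerSeries.X * rulerF) := by
    rw [PowerSeries.isUnit_iff_constantCoeff]; simp
  obtain ⟨V, hV⟩ := hU.exists_right_inv
  refine ⟨PowerSeries.X * V, by rw [mul_assoc, mul_comm V, hV, mul_one], ?_⟩
  have h := rulerF_eq
  have h2 : (1 + PowerSeries.X) * rulerF = PowerSeries.X ^ 2 * V := by
    rw [← h, mul_assoc, mul_assoc, hV, mul_one]
  linear_combination h2 + PowerSeries.X ^ 2 * hV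

lemma HSing_zero (F : PowerSeries (ZMod 2)) : ¬ HSing F 0 := by
  rintro ⟨Q, P, hQ, h, -⟩
  exact hQ (Polynomial.ext fun m => by simpa using h m (by omega))

open Polynomial in
lemma HSing_ruler (n : ℕ) : HSing rulerF n ↔ n % 3 = 1 := by
  obtain ⟨K, hK, hF⟩ := exists_K
  have s1 : ∀ n, HSing K (n + 1) ↔ HSing rulerF n := fun n =>
    HSing_step K rulerF 1 1 n le_rfl (by simp) (by simp) (by simpa using hK)
  have s2 : ∀ n, HSing rulerF (n + 2) ↔ HSing K n := fun n =>
    HSing_step rulerF K (1 + X) 2 n (by norm_num)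
      (by compute_degree; norm_num) (by simp) (by simpa using hF)
  induction n using Nat.strong_induction_on with
  | _ n ih =>
  rcases n with _ | _ | _ | n
  · simp [HSing_zero]
  · simp only [zero_add, Nat.reduceMod, iff_true]
    refine ⟨1, 0, one_ne_zero, ?_, by simp, ?_⟩
    · intro m hm; rw [Polynomial.coeff_one, if_neg (by omega)]
    · rw [PowerSeries.X_pow_dvd_iff]
      intro m hm
      have h2 : ruler 2 = 2 := by
        have h1 : ruler 1 = 1 := ruler_odd 0
        have := ruler_even 1 (by norm_num)
        rw [h1] at this; simpa using this
      interval_cases m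
      · simp [rulerF]
      · simp [rulerF, h2]; decide
  · rw [s2 0]; simp [HSing_zero]
  · have h3 := ih n (by omega)
    rw [s2 (n + 1), s1 n]
    exact h3.trans (by omega)

lemma coeff_link (n : ℕ) (v : Fin n → ZMod 2) (Q : Polynomial (ZMod 2))
    (hQ : ∀ m, n ≤ m → Q.coeff m = 0) (hv : ∀ j : Fin n, Q.coeff (n - 1 - j) = v j) (i : Fin n) :
    PowerSeries.coeff (n + i) (rulerF * (Q : PowerSeries (ZMod 2))) =
      (((hankelMatrix n 2 ruler).map (Int.castRingHom (ZMod 2))).mulVec v) i := by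
  rw [mul_comm, PowerSeries.coeff_mul, Finset.Nat.sum_antidiagonal_eq_sum_range_succ_mk]
  rw [show (n + i).succ = n + (i + 1) by omega, Finset.sum_range_add]
  rw [Finset.sum_eq_zero (s := Finset.range (i + 1)), add_zero, ← Finset.sum_range_reflect,
    Finset.sum_range]
  · simp only [Matrix.mulVec, dotProduct]
    apply Finset.sum_congr rfl
    intro j _
    rw [Polynomial.coeff_coe, hv j, mul_comm]
    congr 1
    have := j.2
    simp only [rulerF, PowerSeries.coeff_mk, hankelMatrix, Matrix.map_apply, Matrix.of_apply]
    rw [if_neg (by omega)]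
    simp only [eq_intCast]
    congr 2
    omega
  · intro x _
    simp [hQ (n + x) (by omega)]

lemma det_link (n : ℕ) : ((hankelMatrix n 2 ruler).map (Int.castRingHom (ZMod 2))).det = 0 ↔
    HSing rulerF n := by
  rw [← Matrix.exists_mulVec_eq_zero_iff]
  constructor
  · rintro ⟨v, hv0, hv⟩
    let c : ℕ → ZMod 2 := fun m => if h : m < n then v ⟨n - 1 - m, by omega⟩ else 0
    let Q : Polynomial (ZMod 2) := PowerSeries.trunc n (PowerSeries.mk c)
    have hQc : ∀ m, Q.coeff m = c m := by
      intro m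
      simp only [Q, PowerSeries.coeff_trunc, PowerSeries.coeff_mk, c]
      split_ifs <;> rfl
    have hQ : ∀ m, n ≤ m → Q.coeff m = 0 := by
      intro m hm; rw [hQc]; simp only [c]; rw [dif_neg (by omega)]
    have hQv : ∀ j : Fin n, Q.coeff (n - 1 - j) = v j := by
      intro j
      have := j.2
      rw [hQc]; simp only [c]; rw [dif_pos (by omega)]
      congr 1; ext; simp; omega
    refine ⟨Q, PowerSeries.trunc n (rulerF * (Q : PowerSeries (ZMod 2))), ?_, hQ, ?_, ?_⟩
    · intro h
      apply hv0
      ext j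
      rw [← hQv j, h]; simp
    · intro m hm
      rw [PowerSeries.coeff_trunc, if_neg (by omega)]
    · rw [PowerSeries.X_pow_dvd_iff]
      intro m hm
      rw [map_sub, Polynomial.coeff_coe, PowerSeries.coeff_trunc]
      split_ifs with h
      · simp
      · obtain ⟨i, rfl⟩ : ∃ i, m = n + i := ⟨m - n, by omega⟩
        have := coeff_link n v Q hQ hQv ⟨i, by omega⟩
        rw [hv] at this
        simpa using this
  · rintro ⟨Q, P, hQ0, hQ, hP, hd⟩
    refine ⟨fun j => Q.coeff (n - 1 - j), ?_, ?_⟩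
    · intro h
      apply hQ0
      ext m
      rcases lt_or_ge m n with hm | hm
      · have := congrFun h ⟨n - 1 - m, by omega⟩
        simp only [Pi.zero_apply] at this
        rw [show n - 1 - (n - 1 - m) = m by omega] at this
        simpa using this
      · simpa using hQ m hm
    · ext i
      rw [← coeff_link n _ Q hQ (fun _ => rfl) i]
      rw [PowerSeries.X_pow_dvd_iff] at hd
      have := hd (n + i) (by omega)
      rw [map_sub, Polynomial.coeff_coe, hP _ (by omega), sub_zero] at this
      simpa using this

theorem det_hankel_ruler_p2_mod_two (n : ℕ) (hn : 1 ≤ n) :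
    ((n % 6 = 1 ∨ n % 6 = 4) → (hankelMatrix n 2 ruler).det ≡ 0 [ZMOD 2]) ∧
    ((n % 6 = 0 ∨ n % 6 = 2 ∨ n % 6 = 3 ∨ n % 6 = 5) →
      (hankelMatrix n 2 ruler).det ≡ 1 [ZMOD 2]) := by
  have h := (det_link n).trans (HSing_ruler n)
  have e : ((hankelMatrix n 2 ruler).map (Int.castRingHom (ZMod 2))).det =
      (((hankelMatrix n 2 ruler).det : ℤ) : ZMod 2) := by
    have := (Int.castRingHom (ZMod 2)).map_det (hankelMatrix n 2 ruler)
    simpa using this.symm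
  rw [e, ZMod.intCast_zmod_eq_zero_iff_dvd] at h
  push_cast at h
  unfold Int.ModEq
  generalize (hankelMatrix n 2 ruler).det = D at *
  constructor
  · intro h1
    have := h.2 (by omega)
    omega
  · intro h1
    have : ¬ ((2:ℤ) ∣ D) := fun hh => by have := h.1 hh; omega
    omega
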